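/- Let (T(t))_{t≥0} be a bounded C₀-semigroup on a complex Hilbert space X with generator A such that 0 belongs to the spectrum of A (note that 1 lies in the resolvent set of A, so A(I−A)^{-k} is a bounded operator on X). Then for each fixed integer n ≥ 1, each real p with 1 ≤ p < ∞, and each k ∈ {1,2}, the following are equivalent: (i) there exist M, t₁ > 0 such that ‖T(t) A(I−A)^{-k}‖ ≤ M t^{-1/(np)} for all t ≥ t₁; (ii) there exists K > 0 such that ‖(A(I−A)^{-k})ⁿ R(λ,A) x‖ ≤ K ‖x‖ / (Re λ)^{1-1/p} for all λ with Re λ > 0 and all x ∈ X. (This is the integer-exponent case α = np of the paper's characterization of decay of orbits starting in ran(A) when k = 1 and in D(A) ∩ ran(A) when k = 2, since (−A)^{np/p}(I−A)^{-k·np/p} = (−1)ⁿ (A(I−A)^{-k})ⁿ.) -/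

import Mathlib

open MeasureTheory FourierTransform Filter Topology

namespace MeasureTheory

variable {F : Type*} [NormedAddCommGroup F] [InnerProductSpace ℂ F] [CompleteSpace F]

/-- On `L¹ ∩ L²`, the `L²` Fourier transform is given by the Fourier integral. -/
theorem Lp.fourier_toLp_ae_eq {f : ℝ → F} (hf : Integrable f) (hf2 : MemLp f 2) :
    ((𝓕 (hf2.toLp f) : Lp (α := ℝ) F 2) : ℝ → F) =ᵐ[volume] 𝓕 f := by
  have hcont : Continuous (𝓕 f) :=
    VectorFourier.fourierIntegral_continuous Real.continuous_fourierChar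
      (L := innerₗ ℝ) continuous_inner hf
  refine ae_eq_of_integral_contDiff_smul_eq
    ((Lp.memLp _).locallyIntegrable (by norm_num)) hcont.locallyIntegrable fun g hg hgc ↦ ?_
  have hg' : ContDiff ℝ ((⊤ : ℕ∞) : WithTop ℕ∞) (fun x ↦ (g x : ℂ)) :=
    Complex.ofRealCLM.contDiff.comp hg
  have hgc' : HasCompactSupport (fun x ↦ (g x : ℂ)) :=
    hgc.comp_left (g := fun y : ℝ ↦ (y : ℂ)) (by simp)
  let φ : SchwartzMap ℝ ℂ := hgc'.toSchwartzMap hg'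
  have hφ (x : ℝ) : φ x = g x := rfl
  have h1 := DFunLike.congr_fun (Lp.fourier_toTemperedDistribution_eq (hf2.toLp f)) φ
  rw [TemperedDistribution.fourier_apply, Lp.toTemperedDistribution_apply,
    Lp.toTemperedDistribution_apply] at h1
  have h2 : ∫ x, 𝓕 (φ : ℝ → ℂ) x • f x = ∫ x, φ x • 𝓕 f x := by
    have := VectorFourier.integral_fourierIntegral_smul_eq_flip (L := innerₗ ℝ) (μ := volume)
      (ν := volume) (f := φ) (g := f) Real.continuous_fourierChar continuous_inner
      φ.integrable hf
    rwa [flip_innerₗ] at this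
  have h3 : ∫ x, (𝓕 φ) x • (hf2.toLp f) x = ∫ x, 𝓕 (φ : ℝ → ℂ) x • f x := by
    refine integral_congr_ae ?_
    filter_upwards [hf2.coeFn_toLp] with x hx
    rw [hx, SchwartzMap.fourier_coe]
  simp only [hφ, Complex.coe_smul] at h1 h2
  rw [← h1, h3, h2]

/-- **Plancherel's theorem** on `L¹ ∩ L²`. -/
theorem eLpNorm_fourier_eq {f : ℝ → F} (hf : Integrable f) (hf2 : MemLp f 2) :
    eLpNorm (𝓕 f) 2 = eLpNorm f 2 := by
  rw [← eLpNorm_congr_ae (Lp.fourier_toLp_ae_eq hf hf2), ← eLpNorm_congr_ae hf2.coeFn_toLp,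
    ← ENNReal.toReal_eq_toReal_iff' (Lp.eLpNorm_ne_top _) (Lp.eLpNorm_ne_top _),
    ← Lp.norm_def, ← Lp.norm_def, Lp.norm_fourier_eq]

theorem eLpNorm_le_mul_of_norm_fourier_le {f g : ℝ → F} (hf : Integrable f) (hf2 : MemLp f 2)
    (hg : Integrable g) (hg2 : MemLp g 2) {K : ℝ} (h : ∀ s, ‖𝓕 g s‖ ≤ K * ‖𝓕 f s‖) :
    eLpNorm g 2 ≤ ENNReal.ofReal K * eLpNorm f 2 := by
  rw [← eLpNorm_fourier_eq hf hf2, ← eLpNorm_fourier_eq hg hg2]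
  exact eLpNorm_le_mul_eLpNorm_of_ae_le_mul (.of_forall h) 2

end MeasureTheory

theorem two_mul_self_mul_exp_neg_le {b : ℝ} (t : ℝ) :
    b * t * Real.exp (-(2 * b) * t) ≤ Real.exp (-b * t) := by
  have h1 : b * t ≤ Real.exp (b * t) := by linarith [Real.add_one_le_exp (b * t)]
  calc b * t * Real.exp (-(2 * b) * t) ≤ Real.exp (b * t) * Real.exp (-(2 * b) * t) := by gcongr
    _ = _ := by rw [← Real.exp_add]; ring_nf

section ExponentialDecay

variable {E : Type*} [NormedAddCommGroup E] {φ : ℝ → E} {C b : ℝ}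

theorem aestronglyMeasurable_indicator_Ioi (hφ : ContinuousOn φ (Set.Ici 0)) :
    AEStronglyMeasurable ((Set.Ioi 0).indicator φ) :=
  (aestronglyMeasurable_indicator_iff measurableSet_Ioi).2
    ((hφ.mono Set.Ioi_subset_Ici_self).aestronglyMeasurable measurableSet_Ioi)

theorem norm_indicator_Ioi_le (h : ∀ t > 0, ‖φ t‖ ≤ C * Real.exp (-b * t)) (t : ℝ) :
    ‖(Set.Ioi 0).indicator φ t‖ ≤
      ‖(Set.Ioi 0).indicator (fun t : ℝ ↦ C * Real.exp (-b * t)) t‖ := by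
  by_cases ht : t ∈ Set.Ioi 0
  · simpa [ht] using (h t ht).trans (le_abs_self _)
  · simp [ht]

theorem integrable_indicator_of_norm_le_exp (hφ : ContinuousOn φ (Set.Ici 0)) (hb : 0 < b)
    (h : ∀ t > 0, ‖φ t‖ ≤ C * Real.exp (-b * t)) :
    Integrable ((Set.Ioi 0).indicator φ) :=
  ((integrable_indicator_iff measurableSet_Ioi).2
    ((integrableOn_exp_mul_Ioi (neg_lt_zero.2 hb) 0).const_mul C)).mono
    (aestronglyMeasurable_indicator_Ioi hφ) (.of_forall (norm_indicator_Ioi_le h))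

theorem eLpNorm_indicator_le_of_norm_le_exp (hb : 0 < b) (hC : 0 ≤ C)
    (h : ∀ t > 0, ‖φ t‖ ≤ C * Real.exp (-b * t)) :
    eLpNorm ((Set.Ioi 0).indicator φ) 2 ≤ ENNReal.ofReal (C / √(2 * b)) := by
  have hlt : ∫⁻ t in Set.Ioi (0 : ℝ), ENNReal.ofReal (C ^ 2 * Real.exp (-(2 * b) * t)) =
      ENNReal.ofReal (C ^ 2 / (2 * b)) := by
    rw [← ofReal_integral_eq_lintegral_ofReal, integral_const_mul,
      integral_exp_mul_Ioi (by linarith)]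
    · congr 1
      simp [div_eq_mul_inv]
    · exact (integrableOn_exp_mul_Ioi (by linarith) 0).const_mul _
    · exact .of_forall fun t ↦ by positivity
  rw [eLpNorm_indicator_eq_eLpNorm_restrict measurableSet_Ioi,
    eLpNorm_eq_lintegral_rpow_enorm_toReal (by norm_num) (by norm_num)]
  have hle : ∫⁻ t in Set.Ioi (0 : ℝ), ‖φ t‖ₑ ^ (2 : ENNReal).toReal ≤
      ENNReal.ofReal (C ^ 2 / (2 * b)) := by
    rw [← hlt]
    refine setLIntegral_mono' measurableSet_Ioi fun t ht ↦ ?_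
    rw [← ofReal_norm, ENNReal.ofReal_rpow_of_nonneg (norm_nonneg _) (by simp)]
    refine ENNReal.ofReal_le_ofReal ?_
    simp only [ENNReal.toReal_ofNat, Real.rpow_ofNat]
    calc ‖φ t‖ ^ 2 ≤ (C * Real.exp (-b * t)) ^ 2 := by gcongr; exact h t ht
      _ = _ := by rw [mul_pow, ← Real.exp_nat_mul]; push_cast; ring_nf
  refine (ENNReal.rpow_le_rpow hle (by simp)).trans ?_
  rw [ENNReal.ofReal_rpow_of_nonneg (by positivity) (by simp)]
  refine ENNReal.ofReal_le_ofReal (le_of_eq ?_)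
  simp only [ENNReal.toReal_ofNat]
  rw [← Real.sqrt_eq_rpow, Real.sqrt_div (by positivity), Real.sqrt_sq hC]

theorem memLp_two_indicator_of_norm_le_exp (hφ : ContinuousOn φ (Set.Ici 0)) (hb : 0 < b)
    (hC : 0 ≤ C) (h : ∀ t > 0, ‖φ t‖ ≤ C * Real.exp (-b * t)) :
    MemLp ((Set.Ioi 0).indicator φ) 2 :=
  ⟨aestronglyMeasurable_indicator_Ioi hφ,
    (eLpNorm_indicator_le_of_norm_le_exp hb hC h).trans_lt ENNReal.ofReal_lt_top⟩

/-- If `Φ` decays exponentially and has right derivative `-φ`, then `∫₀^∞ φ = Φ 0`. -/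
theorem integral_Ioi_eq_of_hasDerivWithinAt_neg [NormedSpace ℝ E] [CompleteSpace E]
    {Φ : ℝ → E} {C' : ℝ}
    (hφ : ContinuousOn φ (Set.Ici 0)) (hb : 0 < b) (h : ∀ t > 0, ‖φ t‖ ≤ C * Real.exp (-b * t))
    (hΦ : ContinuousOn Φ (Set.Ici 0)) (h' : ∀ t > 0, ‖Φ t‖ ≤ C' * Real.exp (-b * t))
    (hderiv : ∀ t > 0, HasDerivWithinAt Φ (-φ t) (Set.Ioi t) t) :
    ∫ t in Set.Ioi 0, φ t = Φ 0 := by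
  have hint : IntegrableOn φ (Set.Ioi 0) :=
    (integrable_indicator_iff measurableSet_Ioi).1 (integrable_indicator_of_norm_le_exp hφ hb h)
  have h1 := intervalIntegral_tendsto_integral_Ioi 0 hint tendsto_id
  have h2 : Tendsto Φ atTop (𝓝 0) := by
    refine squeeze_zero_norm' ((eventually_gt_atTop 0).mono h') ?_
    have : Tendsto (fun t : ℝ ↦ -b * t) atTop atBot :=
      tendsto_id.const_mul_atTop_of_neg (neg_lt_zero.2 hb)
    simpa using (Real.tendsto_exp_atBot.comp this).const_mul C'
  have h3 : Tendsto (fun s ↦ Φ 0 - Φ s) atTop (𝓝 (Φ 0)) := by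
    simpa using h2.const_sub (Φ 0)
  refine tendsto_nhds_unique h1 (h3.congr' ?_)
  filter_upwards [eventually_ge_atTop 0] with s hs
  have := intervalIntegral.integral_eq_sub_of_hasDeriv_right_of_le hs
    (hΦ.mono Set.Icc_subset_Ici_self) (fun t ht ↦ hderiv t ht.1)
    ((hφ.mono (by rw [Set.uIcc_of_le hs]; exact Set.Icc_subset_Ici_self)).intervalIntegrable.neg)
  rw [intervalIntegral.integral_neg] at this
  rw [id, ← neg_sub, ← this, neg_neg]

end ExponentialDecay

/-- `T` is a `C₀`-semigroup bounded by `c` with generator `A` (on the domain `Dom`) and resolvent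
`R` on the open right half-plane. -/
structure IsBoundedSemigroup {X : Type*} [NormedAddCommGroup X] [NormedSpace ℂ X]
    (T : ℝ → X →L[ℂ] X) (c : ℝ) (Dom : Set X) (A : X → X) (R : ℂ → X →L[ℂ] X) : Prop where
  map_zero : T 0 = 1
  map_add : ∀ s t : ℝ, 0 ≤ s → 0 ≤ t → T (s + t) = T s ∘L T t
  continuousOn : ∀ x : X, ContinuousOn (fun t : ℝ => T t x) (Set.Ici 0)
  one_le : 1 ≤ c
  norm_le : ∀ t : ℝ, 0 ≤ t → ‖T t‖ ≤ c
  generator : ∀ x y, (x ∈ Dom ∧ A x = y) ↔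
    Tendsto (fun t : ℝ => (t : ℂ)⁻¹ • (T t x - x)) (𝓝[>] 0) (𝓝 y)
  resolvent_right : ∀ lam : ℂ, 0 < lam.re → ∀ x, R lam x ∈ Dom ∧ lam • R lam x - A (R lam x) = x
  resolvent_left : ∀ lam : ℂ, 0 < lam.re → ∀ x ∈ Dom, R lam (lam • x - A x) = x

namespace IsBoundedSemigroup

variable {X : Type*} [NormedAddCommGroup X] [NormedSpace ℂ X]
  {T : ℝ → X →L[ℂ] X} {c : ℝ} {Dom : Set X} {A : X → X} {R : ℂ → X →L[ℂ] X}
  (H : IsBoundedSemigroup T c Dom A R)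

include H

theorem pos : 0 < c := one_pos.trans_le H.one_le

theorem norm_apply_le {t : ℝ} (ht : 0 ≤ t) (x : X) : ‖T t x‖ ≤ c * ‖x‖ :=
  (T t).le_of_opNorm_le (H.norm_le t ht) x

theorem map_generator {t : ℝ} (ht : 0 ≤ t) {x : X} (hx : x ∈ Dom) :
    T t x ∈ Dom ∧ A (T t x) = T t (A x) := by
  rw [H.generator]
  have h := ((T t).continuous.tendsto _).comp ((H.generator x (A x)).1 ⟨hx, rfl⟩)
  refine h.congr' ?_
  filter_upwards [self_mem_nhdsWithin] with s hs
  have hs' : (0 : ℝ) ≤ s := le_of_lt hs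
  have : T s (T t x) = T t (T s x) := by
    rw [← ContinuousLinearMap.comp_apply, ← ContinuousLinearMap.comp_apply,
      ← H.map_add s t hs' ht, ← H.map_add t s ht hs', add_comm]
  simp [this]

theorem map_resolvent {t : ℝ} (ht : 0 ≤ t) {lam : ℂ} (hl : 0 < lam.re) (x : X) :
    T t (R lam x) = R lam (T t x) := by
  obtain ⟨h1, h2⟩ := H.resolvent_right lam hl x
  obtain ⟨h3, h4⟩ := H.map_generator ht h1
  have := H.resolvent_left lam hl _ h3
  rw [h4, ← map_smul, ← map_sub, h2] at this
  exact this.symm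

theorem commute_resolvent {t : ℝ} (ht : 0 ≤ t) {lam : ℂ} (hl : 0 < lam.re) :
    Commute (T t) (R lam) :=
  ContinuousLinearMap.ext (H.map_resolvent ht hl)

theorem resolvent_one_apply {lam : ℂ} (hl : 0 < lam.re) (x : X) :
    R 1 x + (1 - lam) • R 1 (R lam x) = R lam x := by
  obtain ⟨h1, h2⟩ := H.resolvent_right lam hl x
  have := H.resolvent_left 1 (by simp) _ h1
  rw [← map_smul, ← _root_.map_add]
  conv_rhs => rw [← this]
  congr 1
  nth_rw 1 [← h2]
  module

theorem resolvent_apply_one {lam : ℂ} (hl : 0 < lam.re) (x : X) :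
    R lam x + (lam - 1) • R lam (R 1 x) = R 1 x := by
  obtain ⟨h1, h2⟩ := H.resolvent_right 1 (by simp) x
  have := H.resolvent_left lam hl _ h1
  rw [← map_smul, ← _root_.map_add]
  conv_rhs => rw [← this]
  congr 1
  nth_rw 1 [← h2]
  module

theorem resolvent_one_mul {lam : ℂ} (hl : 0 < lam.re) :
    R 1 + (1 - lam) • (R 1 * R lam) = R lam :=
  ContinuousLinearMap.ext (H.resolvent_one_apply hl)

theorem resolvent_mul_one {lam : ℂ} (hl : 0 < lam.re) :
    R lam + (lam - 1) • (R lam * R 1) = R 1 :=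
  ContinuousLinearMap.ext (H.resolvent_apply_one hl)

theorem hasDerivWithinAt_orbit {t : ℝ} (ht : 0 ≤ t) {x : X} (hx : x ∈ Dom) :
    HasDerivWithinAt (fun s ↦ T s x) (T t (A x)) (Set.Ioi t) t := by
  rw [hasDerivWithinAt_iff_tendsto_slope' (by simp)]
  have h := ((T t).continuous.tendsto _).comp ((H.generator x (A x)).1 ⟨hx, rfl⟩)
  have h2 : Tendsto (fun s : ℝ ↦ s - t) (𝓝[>] t) (𝓝[>] 0) := by
    refine tendsto_nhdsWithin_iff.2 ⟨?_, ?_⟩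
    · have : Tendsto (fun s : ℝ ↦ s - t) (𝓝 t) (𝓝 (t - t)) := tendsto_id.sub_const t
      rw [sub_self] at this
      exact this.mono_left nhdsWithin_le_nhds
    · filter_upwards [self_mem_nhdsWithin] with s hs using Set.mem_Ioi.2 (sub_pos.2 hs)
  refine (h.comp h2).congr' ?_
  filter_upwards [self_mem_nhdsWithin] with s hs
  have hst : 0 ≤ s - t := (sub_pos.2 hs).le
  have : T s = T t ∘L T (s - t) := by rw [← H.map_add t _ ht hst]; congr 1; ring
  rw [slope_def_module, this, ← Complex.coe_smul]
  simp

theorem hasDerivWithinAt_exp_smul_orbit {t : ℝ} (ht : 0 ≤ t) {lam : ℂ} (hl : 0 < lam.re) (x : X) :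
    HasDerivWithinAt (fun s : ℝ ↦ Complex.exp (-lam * s) • T s (R lam x))
      (-(Complex.exp (-lam * t) • T t x)) (Set.Ioi t) t := by
  obtain ⟨h1, h2⟩ := H.resolvent_right lam hl x
  have h3 : HasDerivAt (fun s : ℝ ↦ Complex.exp (-lam * s)) (Complex.exp (-lam * t) * -lam) t := by
    have := ((hasDerivAt_id (t : ℂ)).const_mul (-lam)).cexp.comp_ofReal
    simpa using this
  have h4 := h3.hasDerivWithinAt (s := Set.Ioi t) |>.smul (H.hasDerivWithinAt_orbit ht h1)
  have h5 : T t x = lam • T t (R lam x) - T t (A (R lam x)) := by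
    rw [← map_smul, ← map_sub, h2]
  refine h4.congr_deriv ?_
  rw [h5]
  module

theorem continuousOn_exp_smul (lam : ℂ) (x : X) :
    ContinuousOn (fun s : ℝ ↦ Complex.exp (-lam * s) • T s x) (Set.Ici 0) :=
  ContinuousOn.smul (by fun_prop) (H.continuousOn x)

theorem norm_exp_smul_le {t : ℝ} (ht : 0 ≤ t) (lam : ℂ) (x : X) :
    ‖Complex.exp (-lam * t) • T t x‖ ≤ c * ‖x‖ * Real.exp (-lam.re * t) := by
  rw [norm_smul, Complex.norm_exp, mul_comm]
  have : (-lam * t).re = -lam.re * t := by simp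
  rw [this]
  gcongr
  exact H.norm_apply_le ht x

theorem integral_exp_smul_orbit [CompleteSpace X] {lam : ℂ} (hl : 0 < lam.re) (x : X) :
    ∫ t in Set.Ioi (0 : ℝ), Complex.exp (-lam * t) • T t x = R lam x := by
  have := integral_Ioi_eq_of_hasDerivWithinAt_neg (H.continuousOn_exp_smul lam x) hl
    (fun t ht ↦ H.norm_exp_smul_le ht.le lam x) (H.continuousOn_exp_smul lam (R lam x))
    (fun t ht ↦ H.norm_exp_smul_le ht.le lam (R lam x))
    (fun t ht ↦ H.hasDerivWithinAt_exp_smul_orbit ht.le hl x)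
  simpa [H.map_zero] using this

theorem norm_smul_exp_smul_le {t : ℝ} (ht : 0 ≤ t) {lam : ℂ} (hl : 0 < lam.re) (x : X) :
    ‖t • Complex.exp (-lam * t) • T t x‖ ≤
      2 / lam.re * (c * ‖x‖) * Real.exp (-(lam.re / 2) * t) := by
  rw [norm_smul, Real.norm_of_nonneg ht]
  have h1 := two_mul_self_mul_exp_neg_le (b := lam.re / 2) t
  rw [mul_div_cancel₀ _ two_ne_zero] at h1
  have hc := H.pos
  calc t * ‖Complex.exp (-lam * t) • T t x‖
      ≤ t * (c * ‖x‖ * Real.exp (-lam.re * t)) := by gcongr; exact H.norm_exp_smul_le ht lam x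
    _ = 2 / lam.re * (c * ‖x‖) * (lam.re / 2 * t * Real.exp (-lam.re * t)) := by field_simp
    _ ≤ _ := by gcongr

theorem continuousOn_smul_exp_smul (lam : ℂ) (x : X) :
    ContinuousOn (fun s : ℝ ↦ s • Complex.exp (-lam * s) • T s x) (Set.Ici 0) :=
  continuousOn_id.smul (H.continuousOn_exp_smul lam x)

theorem integral_smul_exp_smul_orbit [CompleteSpace X] {lam : ℂ} (hl : 0 < lam.re) (x : X) :
    ∫ t in Set.Ioi (0 : ℝ), t • Complex.exp (-lam * t) • T t x = R lam (R lam x) := by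
  have hc := H.pos
  have := integral_Ioi_eq_of_hasDerivWithinAt_neg (H.continuousOn_smul_exp_smul lam x) (half_pos hl)
    (fun t ht ↦ H.norm_smul_exp_smul_le ht.le hl x)
    (Φ := fun t : ℝ ↦ t • Complex.exp (-lam * t) • T t (R lam x) +
      Complex.exp (-lam * t) • T t (R lam (R lam x)))
    (C' := 2 / lam.re * (c * ‖R lam x‖) + c * ‖R lam (R lam x)‖)
    ((H.continuousOn_smul_exp_smul lam _).add (H.continuousOn_exp_smul lam _)) ?_ ?_
  · simpa [H.map_zero] using this
  · intro t ht
    refine (norm_add_le _ _).trans ?_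
    rw [add_mul]
    gcongr
    · exact H.norm_smul_exp_smul_le ht.le hl _
    · refine (H.norm_exp_smul_le ht.le lam _).trans ?_
      gcongr
      linarith
  · intro t ht
    have h1 := ((hasDerivWithinAt_id t (Set.Ioi t)).smul
      (H.hasDerivWithinAt_exp_smul_orbit ht.le hl x)).add
      (H.hasDerivWithinAt_exp_smul_orbit ht.le hl (R lam x))
    refine h1.congr_deriv ?_
    simp only [id, one_smul, smul_neg]
    abel

theorem norm_resolvent_apply_le [CompleteSpace X] {lam : ℂ} (hl : 0 < lam.re) (x : X) :
    ‖R lam x‖ ≤ c * ‖x‖ / lam.re := by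
  rw [← H.integral_exp_smul_orbit hl]
  calc _ ≤ ∫ t in Set.Ioi (0 : ℝ), c * ‖x‖ * Real.exp (-lam.re * t) := by
        refine norm_integral_le_of_norm_le
          ((integrableOn_exp_mul_Ioi (neg_lt_zero.2 hl) 0).const_mul _) ?_
        filter_upwards [ae_restrict_mem measurableSet_Ioi] with t ht
        exact H.norm_exp_smul_le (le_of_lt ht) lam x
    _ = _ := by
      rw [integral_const_mul, integral_exp_mul_Ioi (neg_lt_zero.2 hl)]
      simp [div_eq_mul_inv]

theorem norm_resolvent_le [CompleteSpace X] {lam : ℂ} (hl : 0 < lam.re) :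
    ‖R lam‖ ≤ c / lam.re :=
  (R lam).opNorm_le_bound (div_nonneg H.pos.le hl.le)
    fun x ↦ (H.norm_resolvent_apply_le hl x).trans (by rw [div_mul_eq_mul_div])

theorem norm_resolvent_apply_le_orbit {lam : ℂ} (hl : 0 < lam.re) {t : ℝ} (ht : 0 ≤ t) (x : X) :
    ‖R lam x‖ ≤ ‖T t (R lam x)‖ + c * t * ‖x‖ := by
  have hc := H.pos
  have hexp {s : ℝ} (hs : 0 ≤ s) : Real.exp (-lam.re * s) ≤ 1 :=
    Real.exp_le_one_iff.2 (by nlinarith)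
  have := image_norm_le_of_norm_deriv_right_le_deriv_boundary
    (f := fun s : ℝ ↦ Complex.exp (-lam * s) • T s (R lam x) - R lam x) (a := 0) (b := t)
    (f' := fun s : ℝ ↦ -(Complex.exp (-lam * s) • T s x))
    (B := fun s ↦ c * ‖x‖ * s) (B' := fun _ ↦ c * ‖x‖)
    (((H.continuousOn_exp_smul lam _).sub continuousOn_const).mono Set.Icc_subset_Ici_self)
    (fun s hs ↦ ((H.hasDerivWithinAt_exp_smul_orbit hs.1 hl x).Ici_of_Ioi).sub_const _)
    (by simp [H.map_zero]) (fun s ↦ by simpa using (hasDerivAt_id s).const_mul (c * ‖x‖))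
    (fun s hs ↦ by
      rw [norm_neg]
      exact (H.norm_exp_smul_le hs.1 lam x).trans
        (mul_le_of_le_one_right (by positivity) (hexp hs.1)))
    (Set.right_mem_Icc.2 ht)
  have h2 : ‖Complex.exp (-lam * t) • T t (R lam x)‖ ≤ ‖T t (R lam x)‖ := by
    rw [norm_smul, Complex.norm_exp]
    exact mul_le_of_le_one_left (norm_nonneg _) (by simpa using hexp ht)
  have h3 := norm_sub_norm_le (R lam x) (Complex.exp (-lam * t) • T t (R lam x))
  rw [norm_sub_rev] at h3
  linarith [mul_right_comm c ‖x‖ t]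

end IsBoundedSemigroup

theorem fourier_indicator_exp_smul {F : Type*} [NormedAddCommGroup F] [NormedSpace ℂ F]
    (a s : ℝ) (ψ : ℝ → F) :
    𝓕 ((Set.Ioi 0).indicator fun t : ℝ ↦ Complex.exp (-a * t) • ψ t) s =
      ∫ t in Set.Ioi (0 : ℝ), Complex.exp (-(a + 2 * Real.pi * s * Complex.I) * t) • ψ t := by
  rw [Real.fourier_real_eq_integral_exp_smul, ← integral_indicator measurableSet_Ioi]
  congr with t
  by_cases ht : t ∈ Set.Ioi (0 : ℝ)
  · simp only [Set.indicator_of_mem ht, smul_smul, ← Complex.exp_add]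
    congr 2
    push_cast
    ring
  · simp [Set.indicator_of_notMem ht]

namespace IsBoundedSemigroup

/-- A bound on `E * R lam` by a power of `lam.re` gives decay of `E * T t`. -/
theorem norm_apply_orbit_le_rpow {X : Type*} [NormedAddCommGroup X] [InnerProductSpace ℂ X]
    [CompleteSpace X] {T : ℝ → X →L[ℂ] X} {c : ℝ} {Dom : Set X} {A : X → X} {R : ℂ → X →L[ℂ] X}
    (H : IsBoundedSemigroup T c Dom A R) {E : X →L[ℂ] X} (hE : ∀ t, 0 ≤ t → Commute (T t) E)
    {K θ : ℝ} (hK : 0 < K)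
    (hER : ∀ lam : ℂ, 0 < lam.re → ∀ x, ‖E (R lam x)‖ ≤ K * ‖x‖ / lam.re ^ θ)
    {t₀ : ℝ} (ht₀ : 0 < t₀) (x : X) :
    ‖E (T t₀ x)‖ ≤ 2 * Real.exp 1 * c ^ 2 * K * t₀ ^ (θ - 1) * ‖x‖ := by
  have hc := H.pos
  set a : ℝ := t₀⁻¹ with ha
  have ha0 : 0 < a := inv_pos.2 ht₀
  have hare (s : ℝ) : ((a : ℂ) + 2 * Real.pi * s * Complex.I).re = a := by simp
  have hpos (s : ℝ) : 0 < ((a : ℂ) + 2 * Real.pi * s * Complex.I).re := by rw [hare]; exact ha0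
  have hare' : (a : ℂ).re = a := Complex.ofReal_re a
  set φ : ℝ → X := fun t ↦ Complex.exp (-a * t) • T t x with hφ
  set γ : ℝ → X := fun t ↦ Complex.exp (-a * t) • t • E (T t x) with hγ
  have hγ' (t : ℝ) : γ t = E (t • Complex.exp (-a * t) • T t x) := by
    simp only [hγ, ContinuousLinearMap.map_smul_of_tower]
    rw [smul_comm]
  have hφc : ContinuousOn φ (Set.Ici 0) := H.continuousOn_exp_smul a x
  have hφb : ∀ t > 0, ‖φ t‖ ≤ c * ‖x‖ * Real.exp (-a * t) := fun t ht ↦ by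
    simpa [hφ] using H.norm_exp_smul_le (le_of_lt ht) a x
  have hγc : ContinuousOn γ (Set.Ici 0) := by
    rw [funext hγ']
    exact E.continuous.comp_continuousOn (H.continuousOn_smul_exp_smul a x)
  have hγb : ∀ t > 0, ‖γ t‖ ≤ ‖E‖ * (2 / a * (c * ‖x‖)) * Real.exp (-(a / 2) * t) := fun t ht ↦ by
    rw [hγ', mul_assoc]
    exact E.le_opNorm_of_le (H.norm_smul_exp_smul_le ht.le (by rwa [hare']) x)
  have hCφ : 0 ≤ c * ‖x‖ := by positivity
  have hCγ : 0 ≤ ‖E‖ * (2 / a * (c * ‖x‖)) := by positivity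
  have hfourier (s : ℝ) : ‖𝓕 ((Set.Ioi 0).indicator γ) s‖ ≤
      K / a ^ θ * ‖𝓕 ((Set.Ioi 0).indicator φ) s‖ := by
    set lam : ℂ := (a : ℂ) + 2 * Real.pi * s * Complex.I
    rw [hφ, hγ, fourier_indicator_exp_smul, fourier_indicator_exp_smul,
      H.integral_exp_smul_orbit (hpos s)]
    have : ∫ t in Set.Ioi (0 : ℝ), Complex.exp (-lam * t) • t • E (T t x) =
        E (R lam (R lam x)) := by
      rw [← H.integral_smul_exp_smul_orbit (hpos s), ← E.integral_comp_comm]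
      · congr with t
        simp only [ContinuousLinearMap.map_smul_of_tower]
        rw [smul_comm]
      · exact (integrable_indicator_iff measurableSet_Ioi).1
          (integrable_indicator_of_norm_le_exp (H.continuousOn_smul_exp_smul lam x)
            (half_pos (hpos s)) fun t ht ↦ H.norm_smul_exp_smul_le ht.le (hpos s) x)
    rw [this]
    refine (hER lam (hpos s) _).trans (le_of_eq ?_)
    rw [hare]
    ring
  have hupper := (eLpNorm_le_mul_of_norm_fourier_le
    (integrable_indicator_of_norm_le_exp hφc ha0 hφb)
    (memLp_two_indicator_of_norm_le_exp hφc ha0 hCφ hφb)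
    (integrable_indicator_of_norm_le_exp hγc (half_pos ha0) hγb)
    (memLp_two_indicator_of_norm_le_exp hγc (half_pos ha0) hCγ hγb) hfourier).trans
    (mul_le_mul_right (eLpNorm_indicator_le_of_norm_le_exp ha0 hCφ hφb) _)
  set y : ℝ := ‖E (T t₀ x)‖ * Real.exp (-1) * (t₀ / 2) / c with hy
  have hy0 : 0 ≤ y := by positivity
  have hlower : eLpNorm ((Set.Ioc (t₀ / 2) t₀).indicator fun _ ↦ y) 2 ≤
      eLpNorm ((Set.Ioi 0).indicator γ) 2 := by
    refine eLpNorm_mono fun t ↦ ?_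
    by_cases ht : t ∈ Set.Ioc (t₀ / 2) t₀
    · have ht0 : 0 < t := (half_pos ht₀).trans ht.1
      have hcomp : E (T t₀ x) = T (t₀ - t) (E (T t x)) := by
        have h1 : T t₀ = T (t₀ - t) ∘L T t := by
          rw [← H.map_add _ _ (sub_nonneg.2 ht.2) ht0.le, sub_add_cancel]
        rw [h1]
        exact congrArg (fun B : X →L[ℂ] X ↦ B (T t x)) (hE (t₀ - t) (sub_nonneg.2 ht.2)).eq.symm
      have hle : ‖E (T t₀ x)‖ ≤ c * ‖E (T t x)‖ := by
        rw [hcomp]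
        exact H.norm_apply_le (sub_nonneg.2 ht.2) _
      have hexp : ‖Complex.exp (-a * t)‖ = Real.exp (-(a * t)) := by
        rw [Complex.norm_exp]; simp
      have hat : a * t ≤ 1 := by
        rw [ha, inv_mul_le_iff₀ ht₀, mul_one]; exact ht.2
      rw [Set.indicator_of_mem ht, Set.indicator_of_mem (Set.mem_Ioi.2 ht0), hγ]
      simp only [norm_smul, hexp]
      rw [Real.norm_of_nonneg hy0, Real.norm_of_nonneg ht0.le, hy, div_le_iff₀ hc]
      calc ‖E (T t₀ x)‖ * Real.exp (-1) * (t₀ / 2)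
          ≤ (c * ‖E (T t x)‖) * Real.exp (-(a * t)) * t := by
            gcongr
            exact ht.1.le
        _ = _ := by ring
    · rw [Set.indicator_of_notMem ht, norm_zero]
      exact norm_nonneg _
  rw [eLpNorm_indicator_const measurableSet_Ioc (by norm_num) (by norm_num), Real.volume_Ioc,
    ENNReal.ofReal_rpow_of_nonneg (by linarith) (by norm_num), ← ofReal_norm,
    Real.norm_of_nonneg hy0, ← ENNReal.ofReal_mul hy0] at hlower
  have h := hlower.trans hupper
  rw [← ENNReal.ofReal_mul (by positivity), ENNReal.ofReal_le_ofReal_iff (by positivity)] at h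
  have hsqrt : (t₀ - t₀ / 2) ^ (1 / (2 : ENNReal).toReal) = (√(2 * a))⁻¹ := by
    rw [ENNReal.toReal_ofNat, ← Real.sqrt_eq_rpow, ← Real.sqrt_inv, ha]
    congr 1
    field_simp
    norm_num
  have hs0 : 0 < (√(2 * a))⁻¹ := by positivity
  rw [hsqrt, div_eq_mul_inv (c * ‖x‖), ← mul_assoc, mul_le_mul_iff_left₀ hs0, hy,
    ha, Real.inv_rpow ht₀.le, div_inv_eq_mul, div_le_iff₀ hc, Real.exp_neg] at h
  rw [Real.rpow_sub_one ht₀.ne']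
  have he := Real.exp_pos 1
  field_simp at h ⊢
  linarith

end IsBoundedSemigroup

/-- A log-convexity type condition with constant controls the second term of a sequence. -/
theorem exists_pow_le_of_sq_le (C : ℝ) (hC : 0 ≤ C) (n : ℕ) : ∃ C' > 0, ∀ a : ℕ → ℝ,
    (∀ j, 0 ≤ a j) → (∀ j, a (j + 1) ^ 2 ≤ C * a j * a (j + 2)) →
    a 1 ^ (n + 1) ≤ C' * a 0 ^ n * a (n + 1) := by
  induction n with
  | zero => exact ⟨1, one_pos, fun a _ _ ↦ by simp⟩
  | succ n ih =>
    obtain ⟨C', hC', h⟩ := ih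
    refine ⟨C ^ (n + 1) * C' + 1, by positivity, fun a ha ha' ↦ ?_⟩
    have ha0 := ha 0
    have ha2 := ha 2
    have han := ha (n + 1 + 1)
    suffices a 1 ^ (n + 1 + 1) ≤ C ^ (n + 1) * C' * a 0 ^ (n + 1) * a (n + 1 + 1) by
      have : 0 ≤ a 0 ^ (n + 1) * a (n + 1 + 1) := by positivity
      linarith
    rcases (ha 1).eq_or_lt with h1 | h1
    · rw [← h1, zero_pow (by simp)]
      positivity
    have hshift := h (fun j ↦ a (j + 1)) (fun j ↦ ha _) (fun j ↦ ha' _)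
    have hpow : a 1 ^ (n + 1 + 1) * a 1 ^ n ≤
        C ^ (n + 1) * C' * a 0 ^ (n + 1) * a (n + 1 + 1) * a 1 ^ n := by
      calc a 1 ^ (n + 1 + 1) * a 1 ^ n = (a 1 ^ 2) ^ (n + 1) := by ring
        _ ≤ (C * a 0 * a 2) ^ (n + 1) := by gcongr; exact ha' 0
        _ = C ^ (n + 1) * a 0 ^ (n + 1) * a 2 ^ (n + 1) := by ring
        _ ≤ C ^ (n + 1) * a 0 ^ (n + 1) * (C' * a 1 ^ n * a (n + 1 + 1)) := by
          gcongr
        _ = _ := by ring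
    exact le_of_mul_le_mul_right hpow (by positivity)

theorem sq_le_of_forall_le_mul_add_div {C d α β : ℝ} (hd : 0 ≤ d) (hC : 0 < C) (hα : 0 ≤ α)
    (hβ : 0 ≤ β) (h : ∀ s > 0, d ≤ C * (s * α + β / s)) : d ^ 2 ≤ 4 * C ^ 2 * α * β := by
  rcases hd.eq_or_lt with rfl | hd
  · rw [zero_pow two_ne_zero]
    positivity
  rcases hα.eq_or_lt with rfl | hα
  · have h1 := h (2 * C * (β + 1) / d) (by positivity)
    rw [mul_zero, zero_add] at h1
    have h2 : C * (β / (2 * C * (β + 1) / d)) = d * (β / (2 * (β + 1))) := by field_simp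
    have h3 : β / (2 * (β + 1)) < 1 := by rw [div_lt_one (by positivity)]; linarith
    rw [h2] at h1
    nlinarith
  · have h1 := h (d / (2 * C * α)) (by positivity)
    have h2 : C * (d / (2 * C * α) * α + β / (d / (2 * C * α))) = d / 2 + 2 * C ^ 2 * α * β / d := by
      field_simp
    rw [h2] at h1
    have h3 : d / 2 ≤ 2 * C ^ 2 * α * β / d := by linarith
    rw [le_div_iff₀ hd] at h3
    linarith

/-- Moment inequality for powers of `B` when `-B` is sectorial. -/
theorem exists_norm_apply_pow_le {X : Type*} [NormedAddCommGroup X] [NormedSpace ℂ X]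
    {B : X →L[ℂ] X} {C : ℝ} (hC : 0 ≤ C)
    (h : ∀ s : ℝ, 0 < s → ∃ P : X →L[ℂ] X, P * ((s : ℂ) • 1 - B) = 1 ∧ ‖P‖ ≤ C / s) (n : ℕ) :
    ∃ C' > 0, ∀ x, ‖B x‖ ^ (n + 1) ≤ C' * ‖x‖ ^ n * ‖(B ^ (n + 1)) x‖ := by
  have hsq (x : X) : ‖B x‖ ^ 2 ≤ 4 * (C + 1) ^ 2 * ‖x‖ * ‖B (B x)‖ := by
    refine sq_le_of_forall_le_mul_add_div (norm_nonneg _) (by positivity) (norm_nonneg _)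
      (norm_nonneg _) fun s hs ↦ ?_
    obtain ⟨P, hP, hPn⟩ := h s hs
    have hP' (z : X) : (s : ℂ) • P z - P (B z) = z := by
      simpa using DFunLike.congr_fun hP z
    have hPz (z : X) : ‖P z‖ ≤ C / s * ‖z‖ := P.le_of_opNorm_le hPn z
    have hPB : P (B x) = (s : ℂ) • P x - x := (sub_eq_iff_eq_add.1 (hP' x)).symm ▸ by abel
    have hB : B x = (s : ℂ) • ((s : ℂ) • P x - x) - P (B (B x)) := by
      rw [← hPB, hP']
    have hs' : ‖(s : ℂ)‖ = s := by simp [hs.le]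
    calc ‖B x‖ ≤ s * (s * (C / s * ‖x‖) + ‖x‖) + C / s * ‖B (B x)‖ := by
          refine (congrArg norm hB).trans_le ?_
          refine (norm_sub_le _ _).trans (add_le_add ?_ (hPz _))
          rw [norm_smul, hs']
          gcongr
          refine (norm_sub_le _ _).trans ?_
          rw [norm_smul, hs']
          gcongr
          exact hPz x
      _ = (C + 1) * (s * ‖x‖) + C * (‖B (B x)‖ / s) := by field_simp
      _ ≤ (C + 1) * (s * ‖x‖) + (C + 1) * (‖B (B x)‖ / s) := by gcongr; linarith
      _ = _ := by ring
  obtain ⟨C', hC', h'⟩ := exists_pow_le_of_sq_le (4 * (C + 1) ^ 2) (by positivity) n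
  refine ⟨C', hC', fun x ↦ ?_⟩
  have := h' (fun j ↦ ‖(B ^ j) x‖) (fun j ↦ norm_nonneg _) fun j ↦ by
    simpa [pow_succ'] using hsq ((B ^ j) x)
  simpa using this

namespace IsBoundedSemigroup

variable {X : Type*} [NormedAddCommGroup X] [NormedSpace ℂ X] [CompleteSpace X]
  {T : ℝ → X →L[ℂ] X} {c : ℝ} {Dom : Set X} {A : X → X} {R : ℂ → X →L[ℂ] X}
  (H : IsBoundedSemigroup T c Dom A R)

include H

theorem norm_resolvent_ofReal_le {a : ℝ} (ha : 0 < a) : ‖R a‖ ≤ c / a := by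
  simpa using H.norm_resolvent_le (lam := a) (by simpa using ha)

/-- Sectoriality of `-A (I - A)⁻¹`. -/
theorem exists_left_inverse_one {s : ℝ} (hs : 0 < s) :
    ∃ P : X →L[ℂ] X, P * ((s : ℂ) • 1 - (R 1 - 1)) = 1 ∧ ‖P‖ ≤ (1 + c * (1 + c)) / s := by
  have hc := H.one_le
  set b : ℝ := s / (s + 1) with hb
  have hb0 : 0 < b := by positivity
  have hs1 : (s : ℂ) + 1 ≠ 0 := by exact_mod_cast (by positivity : s + 1 ≠ 0)
  have h1 := H.resolvent_mul_one (lam := b) (by simpa using hb0)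
  have hb1 : (b : ℂ) - 1 = -((s : ℂ) + 1)⁻¹ := by
    rw [hb]
    push_cast
    field_simp
    ring
  rw [hb1] at h1
  refine ⟨((s : ℂ) + 1)⁻¹ • (1 + ((s : ℂ) + 1)⁻¹ • R b), ?_, ?_⟩
  · have h2 : (1 + ((s : ℂ) + 1)⁻¹ • R b) * ((s : ℂ) • 1 - (R 1 - 1)) =
        ((s : ℂ) + 1) • 1 := by
      calc _ = (s : ℂ) • 1 - (R 1 - 1) + ((((s : ℂ) + 1)⁻¹ * (s + 1)) • R b +
          (-((s : ℂ) + 1)⁻¹) • (R b * R 1)) := by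
            simp only [add_mul, mul_sub, one_mul, smul_mul_assoc, mul_smul_comm, mul_one]
            module
        _ = _ := by
          rw [inv_mul_cancel₀ hs1, one_smul, h1]
          module
    rw [smul_mul_assoc, h2, smul_smul, inv_mul_cancel₀ hs1, one_smul]
  · have hn : ‖((s : ℂ) + 1)⁻¹‖ = (s + 1)⁻¹ := by
      rw [norm_inv]
      congr 1
      have : (s : ℂ) + 1 = ((s + 1 : ℝ) : ℂ) := by push_cast; rfl
      rw [this, Complex.norm_real, Real.norm_of_nonneg (by positivity)]
    calc _ ≤ (s + 1)⁻¹ * (1 + (s + 1)⁻¹ * (c / b)) := by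
          rw [norm_smul, hn]
          gcongr
          refine (norm_add_le _ _).trans (add_le_add ContinuousLinearMap.norm_id_le ?_)
          rw [norm_smul, hn]
          gcongr
          exact H.norm_resolvent_ofReal_le hb0
      _ = (s + c) / (s + 1) / s := by
          rw [hb]
          field_simp
      _ ≤ _ := by
          gcongr
          rw [div_le_iff₀ (by positivity)]
          nlinarith [mul_nonneg hs.le (sq_nonneg c), sq_nonneg c]

/-- Sectoriality of `-A (I - A)⁻²`. -/
theorem exists_left_inverse_two {s : ℝ} (hs : 0 < s) :
    ∃ P : X →L[ℂ] X, P * ((s : ℂ) • 1 - (R 1 - 1) * R 1) = 1 ∧ ‖P‖ ≤ (1 + c * (1 + c)) / s := by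
  have hc := H.one_le
  obtain ⟨a, ha1, hsa⟩ : ∃ a : ℝ, 1 < a ∧ s * (a - 1) ^ 2 = a := by
    obtain ⟨w, hw, hq⟩ : ∃ w : ℝ, 0 ≤ w ∧ w ^ 2 = 1 + 4 * s :=
      ⟨√(1 + 4 * s), Real.sqrt_nonneg _, Real.sq_sqrt (by positivity)⟩
    refine ⟨1 + (1 + w) / (2 * s), ?_, ?_⟩
    · have : 0 < (1 + w) / (2 * s) := by positivity
      linarith
    · field_simp
      linear_combination hq
  have ha0 : 0 < a := one_pos.trans ha1
  have hac : (a : ℂ) ≠ 0 := by exact_mod_cast ha0.ne'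
  have hsc : (s : ℂ) ≠ 0 := by exact_mod_cast hs.ne'
  have hu := H.resolvent_mul_one (lam := a) (by simpa using ha0)
  have hv := H.resolvent_mul_one (lam := ((a⁻¹ : ℝ) : ℂ)) (by simpa using ha0)
  have hun := H.norm_resolvent_ofReal_le ha0
  have hvn := H.norm_resolvent_ofReal_le (inv_pos.2 ha0)
  set r := R 1
  set u := R a
  set v := R ((a⁻¹ : ℝ) : ℂ)
  rw [Complex.ofReal_inv] at hv
  have hfac : (s : ℂ) • (1 : X →L[ℂ] X) - (r - 1) * r =
      (s : ℂ) • ((1 + ((a : ℂ)⁻¹ - 1) • r) * (1 + ((a : ℂ) - 1) • r)) := by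
    have h2 : (s : ℂ) * (((a : ℂ)⁻¹ - 1) + (a - 1)) = 1 := by
      field_simp
      have : (s : ℂ) * (a - 1) ^ 2 = a := by exact_mod_cast hsa
      linear_combination this
    have h3 : (s : ℂ) * (((a : ℂ)⁻¹ - 1) * (a - 1)) = -1 := by
      field_simp
      have : (s : ℂ) * (a - 1) ^ 2 = a := by exact_mod_cast hsa
      linear_combination -this
    calc _ = (s : ℂ) • 1 + (1 : ℂ) • r + (-1 : ℂ) • (r * r) := by
          rw [sub_mul, one_mul]
          module
      _ = (s : ℂ) • 1 + ((s : ℂ) * (((a : ℂ)⁻¹ - 1) + (a - 1))) • r +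
          ((s : ℂ) * (((a : ℂ)⁻¹ - 1) * (a - 1))) • (r * r) := by rw [h2, h3]
      _ = _ := by
          simp only [add_mul, mul_add, one_mul, mul_one, smul_mul_assoc, mul_smul_comm]
          module
  have hv' : (1 - (a : ℂ)⁻¹ • v) * (1 + ((a : ℂ)⁻¹ - 1) • r) = 1 - r := by
    calc _ = 1 + ((a : ℂ)⁻¹ - 1) • r - (a : ℂ)⁻¹ • (v + ((a : ℂ)⁻¹ - 1) • (v * r)) := by
          simp only [sub_mul, mul_add, one_mul, mul_one, smul_mul_assoc, mul_smul_comm]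
          module
      _ = _ := by rw [hv]; module
  have hu' : u * (1 - r) * (1 + ((a : ℂ) - 1) • r) = r * (1 - r) := by
    calc _ = (u + ((a : ℂ) - 1) • (u * r)) * (1 - r) := by
          simp only [sub_mul, add_mul, mul_sub, mul_add, mul_one, smul_mul_assoc, mul_smul_comm,
            mul_assoc]
          module
      _ = _ := by rw [hu]
  have hmain : u * (1 - (a : ℂ)⁻¹ • v) * ((s : ℂ) • 1 - (r - 1) * r) =
      (s : ℂ) • (r * (1 - r)) := by
    rw [hfac, mul_smul_comm, ← hu', ← hv']
    simp only [mul_assoc]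
  refine ⟨(s : ℂ)⁻¹ • (1 - (s : ℂ)⁻¹ • (u * (1 - (a : ℂ)⁻¹ • v))), ?_, ?_⟩
  · rw [smul_mul_assoc, sub_mul, one_mul, smul_mul_assoc, hmain, smul_smul, inv_mul_cancel₀ hsc,
      one_smul, inv_smul_eq_iff₀ hsc, sub_mul, mul_sub, mul_one, one_mul]
    abel
  · have hns : ‖(s : ℂ)⁻¹‖ = s⁻¹ := by simp [hs.le]
    have hna : ‖(a : ℂ)⁻¹‖ = a⁻¹ := by simp [ha0.le]
    have h1 : ‖1 - (a : ℂ)⁻¹ • v‖ ≤ 1 + c := by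
      refine (norm_sub_le _ _).trans (add_le_add ContinuousLinearMap.norm_id_le ?_)
      rw [norm_smul, hna]
      calc a⁻¹ * ‖v‖ ≤ a⁻¹ * (c / a⁻¹) := by gcongr
        _ = c := by field_simp
    have h2 : s⁻¹ * a⁻¹ ≤ 1 := by
      rw [← mul_inv, inv_le_one₀ (by positivity), ← sub_nonneg]
      have : s * a = a ^ 2 / (a - 1) ^ 2 := by
        rw [eq_div_iff (pow_ne_zero 2 (sub_ne_zero.2 ha1.ne'))]
        linear_combination a * hsa
      rw [this, sub_nonneg, le_div_iff₀ (by nlinarith), one_mul]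
      nlinarith
    calc _ ≤ s⁻¹ * (1 + s⁻¹ * (c / a * (1 + c))) := by
          rw [norm_smul, hns]
          gcongr
          refine (norm_sub_le _ _).trans (add_le_add ContinuousLinearMap.norm_id_le ?_)
          rw [norm_smul, hns]
          gcongr
          exact (norm_mul_le _ _).trans (by gcongr)
      _ = s⁻¹ * (1 + s⁻¹ * a⁻¹ * (c * (1 + c))) := by ring
      _ ≤ s⁻¹ * (1 + 1 * (c * (1 + c))) := by gcongr
      _ = _ := by ring

end IsBoundedSemigroup

theorem exists_pow_mul_eq_smul_add {X : Type*} [NormedAddCommGroup X] [NormedSpace ℂ X]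
    (B : X →L[ℂ] X) {q : ℝ} (hq : 0 < q) (n : ℕ) : ∃ q' > 0, ∀ (U Q : X →L[ℂ] X) (μ : ℂ),
      ‖μ‖ ≤ q → ‖Q‖ ≤ q → B * U = μ • U + Q →
      ∃ Q' : X →L[ℂ] X, ‖Q'‖ ≤ q' ∧ B ^ n * U = μ ^ n • U + Q' := by
  induction n with
  | zero => exact ⟨1, one_pos, fun U Q μ _ _ _ ↦ ⟨0, by simp, by simp⟩⟩
  | succ n ih =>
    obtain ⟨q', hq', h⟩ := ih
    refine ⟨q * q' + ‖B ^ n‖ * q, by positivity, fun U Q μ hμ hQ hU ↦ ?_⟩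
    obtain ⟨Q', hQ', h'⟩ := h U Q μ hμ hQ hU
    refine ⟨μ • Q' + B ^ n * Q, ?_, ?_⟩
    · refine (norm_add_le _ _).trans (add_le_add ?_ ((norm_mul_le _ _).trans (by gcongr)))
      rw [norm_smul]
      gcongr
    · rw [pow_succ, mul_assoc, hU, mul_add, mul_smul_comm, h', pow_succ']
      module

namespace IsBoundedSemigroup

variable {X : Type*} [NormedAddCommGroup X] [NormedSpace ℂ X]
  {T : ℝ → X →L[ℂ] X} {c : ℝ} {Dom : Set X} {A : X → X} {R : ℂ → X →L[ℂ] X}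
  (H : IsBoundedSemigroup T c Dom A R)

include H

theorem exists_mul_resolvent_eq {k : ℕ} (hk : k = 1 ∨ k = 2) : ∃ q > 0, ∀ lam : ℂ,
    0 < lam.re → lam.re < 1 / 2 → ∃ (μ : ℂ) (Q : X →L[ℂ] X), ‖μ‖ ≤ q ∧ ‖Q‖ ≤ q ∧
      ((R 1 - 1) * R 1 ^ (k - 1)) * R lam = μ • R lam + Q := by
  set r := R 1 with hr
  refine ⟨6 + 4 * ‖r‖ + 2 * ‖(r - 1) * r‖, by positivity, fun lam hl hl' ↦ ?_⟩
  have hdist : 1 / 2 ≤ ‖1 - lam‖ := by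
    have := Complex.re_le_norm (1 - lam)
    simp only [Complex.sub_re, Complex.one_re] at this
    linarith
  have hne : 1 - lam ≠ 0 := fun h ↦ by
    rw [h, norm_zero] at hdist
    norm_num at hdist
  set ν : ℂ := (1 - lam)⁻¹ with hν
  have hνn : ‖ν‖ ≤ 2 := by
    rw [hν, norm_inv]
    exact inv_le_of_inv_le₀ two_pos (by linarith)
  have hν1 : ‖ν - 1‖ ≤ 3 := by
    refine (norm_sub_le _ _).trans ?_
    rw [norm_one]
    linarith
  have hn0 := norm_nonneg ν
  have hr0 := norm_nonneg r
  have hs0 := norm_nonneg ((r - 1) * r)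
  have hru : r * R lam = ν • R lam - ν • r := by
    rw [← smul_sub, hν, eq_inv_smul_iff₀ hne, eq_sub_iff_add_eq, add_comm]
    exact H.resolvent_one_mul hl
  have h1 : (r - 1) * R lam = (ν - 1) • R lam - ν • r := by
    rw [sub_mul, hru, one_mul]
    module
  rcases hk with rfl | rfl
  · refine ⟨ν - 1, -(ν • r), by linarith, ?_, ?_⟩
    · rw [norm_neg, norm_smul]
      nlinarith
    · rw [Nat.sub_self, pow_zero, mul_one, h1, sub_eq_add_neg]
  · refine ⟨ν * (ν - 1), -((ν * ν) • r) - ν • ((r - 1) * r), ?_, ?_, ?_⟩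
    · rw [norm_mul]
      nlinarith [norm_nonneg (ν - 1)]
    · refine (norm_sub_le _ _).trans ?_
      rw [norm_neg, norm_smul, norm_smul, norm_mul]
      have : ‖ν‖ * ‖ν‖ ≤ 4 := by nlinarith
      nlinarith
    · rw [pow_one, mul_assoc, hru, mul_sub, mul_smul_comm, mul_smul_comm, h1]
      module

/-- If `B * R lam ≈ μ • R lam` and `T t * B` decays like `t ^ (-1 / α)`, then the resolvent grows
at most like `‖μ‖ ^ (-α)`. -/
theorem norm_rpow_mul_resolvent_le {B : X →L[ℂ] X} {M t₁ α q : ℝ} (hM : 0 < M) (ht₁ : 0 < t₁)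
    (hα : 1 ≤ α) (hB : ∀ t, t₁ ≤ t → ‖T t ∘L B‖ ≤ M * t ^ (-(1 / α))) {lam μ : ℂ}
    (hl : 0 < lam.re) {Q : X →L[ℂ] X} (hμ : ‖μ‖ ≤ q) (hQ : ‖Q‖ ≤ q)
    (hBR : B * R lam = μ • R lam + Q) (x : X) :
    ‖μ‖ ^ α * ‖R lam x‖ ≤ 2 * c * (q ^ α + t₁ * q ^ α + (2 * M) ^ α) * ‖x‖ := by
  have hc := H.pos
  have hα0 : 0 < α := by linarith
  have hq0 : 0 ≤ q := (norm_nonneg _).trans hμ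
  rcases (norm_nonneg μ).eq_or_lt with h0 | h0
  · rw [← h0, Real.zero_rpow hα0.ne', zero_mul]
    positivity
  set t := t₁ + (2 * M / ‖μ‖) ^ α with ht
  have ht1 : t₁ ≤ t := by rw [ht]; exact le_add_of_nonneg_right (by positivity)
  have ht0 : 0 < t := ht₁.trans_le ht1
  have hdecay : M * t ^ (-(1 / α)) ≤ ‖μ‖ / 2 := by
    have h1 : t ^ (-(1 / α)) ≤ ((2 * M / ‖μ‖) ^ α) ^ (-(1 / α)) :=
      Real.rpow_le_rpow_of_nonpos (by positivity) (by linarith) (by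
        rw [neg_nonpos]; positivity)
    rw [← Real.rpow_mul (by positivity), mul_neg, mul_one_div_cancel hα0.ne', Real.rpow_neg_one,
      inv_div] at h1
    calc M * t ^ (-(1 / α)) ≤ M * (‖μ‖ / (2 * M)) := by gcongr
      _ = _ := by field_simp
  set y := R lam x
  have hBy : B y = μ • y + Q x := DFunLike.congr_fun hBR x
  have hTy : μ • T t y = (T t ∘L B) y - T t (Q x) := by
    rw [ContinuousLinearMap.comp_apply, hBy, _root_.map_add, map_smul, add_sub_cancel_right]
  have h1 : ‖μ‖ * ‖T t y‖ ≤ ‖μ‖ / 2 * ‖y‖ + c * (q * ‖x‖) := by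
    rw [← norm_smul, hTy]
    refine (norm_sub_le _ _).trans (add_le_add
      ((T t ∘L B).le_of_opNorm_le ((hB t ht1).trans hdecay) y) ?_)
    refine (H.norm_apply_le ht0.le _).trans ?_
    gcongr
    exact Q.le_of_opNorm_le hQ x
  have h2 : ‖y‖ ≤ ‖T t y‖ + c * t * ‖x‖ := H.norm_resolvent_apply_le_orbit hl ht0.le x
  have h3 : ‖μ‖ * ‖y‖ ≤ 2 * c * (q + t * ‖μ‖) * ‖x‖ := by
    have := mul_le_mul_of_nonneg_left h2 h0.le
    linarith
  have hsplit (z : ℝ) (hz : 0 ≤ z) : z ^ α = z ^ (α - 1) * z := by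
    rcases hz.eq_or_lt with rfl | hz
    · rw [mul_zero, Real.zero_rpow hα0.ne']
    · rw [Real.rpow_sub_one hz.ne', div_mul_cancel₀ _ hz.ne']
  have htμ : t * ‖μ‖ ^ α ≤ t₁ * q ^ α + (2 * M) ^ α := by
    rw [ht, add_mul, ← Real.mul_rpow (by positivity) h0.le, div_mul_cancel₀ _ h0.ne']
    gcongr
  calc ‖μ‖ ^ α * ‖y‖ = ‖μ‖ ^ (α - 1) * (‖μ‖ * ‖y‖) := by
        rw [hsplit _ h0.le, mul_assoc]
    _ ≤ ‖μ‖ ^ (α - 1) * (2 * c * (q + t * ‖μ‖) * ‖x‖) := by gcongr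
    _ = 2 * c * (‖μ‖ ^ (α - 1) * q + t * ‖μ‖ ^ α) * ‖x‖ := by
        rw [hsplit _ h0.le]; ring
    _ ≤ 2 * c * (q ^ α + (t₁ * q ^ α + (2 * M) ^ α)) * ‖x‖ := by
        rw [hsplit q hq0]
        rw [hsplit q hq0] at htμ
        gcongr
    _ = _ := by ring

theorem exists_norm_pow_apply_resolvent_le [CompleteSpace X] {k : ℕ} (hk : k = 1 ∨ k = 2) {n : ℕ}
    (hn : 1 ≤ n) {p : ℝ} (hp : 1 ≤ p) {M t₁ : ℝ} (hM : 0 < M) (ht₁ : 0 < t₁)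
    (hB : ∀ t : ℝ, t₁ ≤ t →
      ‖(T t) ∘L ((R 1 - 1) * (R 1) ^ (k - 1))‖ ≤ M * t ^ (-(1 / ((n : ℝ) * p)))) :
    ∃ K > 0, ∀ lam : ℂ, 0 < lam.re → ∀ x : X,
      ‖(((R 1 - 1) * (R 1) ^ (k - 1)) ^ n) (R lam x)‖ ≤ K * ‖x‖ / lam.re ^ (1 - 1 / p) := by
  have hc := H.pos
  obtain ⟨q, hq, hμQ⟩ := H.exists_mul_resolvent_eq hk
  set B := (R 1 - 1) * (R 1) ^ (k - 1) with hBdef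
  obtain ⟨q', hq', hpow⟩ := exists_pow_mul_eq_smul_add B hq n
  have hn' : (1 : ℝ) ≤ n := by exact_mod_cast hn
  have hp0 : 0 < p := by linarith
  have hα : 1 ≤ (n : ℝ) * p := by nlinarith
  set α := (n : ℝ) * p with hαdef
  have hp1 : 1 / p ≤ 1 := by rw [div_le_one hp0]; exact hp
  have hp1' : 0 < 1 / p := by positivity
  have hθ : 0 ≤ 1 - 1 / p := by linarith
  set L := 2 * c * (q ^ α + t₁ * q ^ α + (2 * M) ^ α) with hL
  have hL0 : 0 < L := by positivity
  refine ⟨‖B ^ n‖ * c * 2 + L ^ (1 / p) * c ^ (1 - 1 / p) + q', by positivity, fun lam hl x ↦ ?_⟩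
  set a := lam.re with ha
  have haθ : 0 < a ^ (1 - 1 / p) := Real.rpow_pos_of_pos hl _
  rw [le_div_iff₀ haθ]
  have hRx := H.norm_resolvent_apply_le hl x
  have hx := norm_nonneg x
  have hLc : 0 < L ^ (1 / p) * c ^ (1 - 1 / p) := by positivity
  rcases lt_or_ge a (1 / 2) with hlt | hge
  · obtain ⟨μ, Q, hμ, hQ, hBR⟩ := hμQ lam hl hlt
    obtain ⟨Q', hQ', hBn⟩ := hpow (R lam) Q μ hμ hQ hBR
    have h1 : ‖μ‖ ^ α * ‖R lam x‖ ≤ L * ‖x‖ :=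
      H.norm_rpow_mul_resolvent_le hM ht₁ hα hB hl hμ hQ hBR x
    have h2 : ‖μ‖ ^ n * ‖R lam x‖ * a ^ (1 - 1 / p) ≤ L ^ (1 / p) * c ^ (1 - 1 / p) * ‖x‖ := by
      have hsplit (z : ℝ) (hz : 0 ≤ z) : z ^ (1 / p) * z ^ (1 - 1 / p) = z := by
        rw [← Real.rpow_add_of_nonneg hz hp1'.le hθ, add_sub_cancel, Real.rpow_one]
      have hμn : (‖μ‖ ^ α) ^ (1 / p) = ‖μ‖ ^ n := by
        rw [← Real.rpow_mul (norm_nonneg _), hαdef, mul_assoc, mul_one_div_cancel hp0.ne', mul_one,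
          Real.rpow_natCast]
      calc ‖μ‖ ^ n * ‖R lam x‖ * a ^ (1 - 1 / p)
          = (‖μ‖ ^ α * ‖R lam x‖) ^ (1 / p) * (‖R lam x‖ * a) ^ (1 - 1 / p) := by
            rw [Real.mul_rpow (by positivity) (norm_nonneg _),
              Real.mul_rpow (norm_nonneg _) hl.le, hμn]
            conv_lhs => rw [← hsplit ‖R lam x‖ (norm_nonneg _)]
            ring
        _ ≤ (L * ‖x‖) ^ (1 / p) * (c * ‖x‖) ^ (1 - 1 / p) := by
            have h5 : ‖R lam x‖ * a ≤ c * ‖x‖ := (le_div_iff₀ hl).1 hRx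
            gcongr
        _ = _ := by
            rw [Real.mul_rpow hL0.le hx, Real.mul_rpow hc.le hx]
            conv_rhs => rw [← hsplit ‖x‖ hx]
            ring
    have h3 : (B ^ n) (R lam x) = μ ^ n • R lam x + Q' x := DFunLike.congr_fun hBn x
    have h4 : ‖Q' x‖ * a ^ (1 - 1 / p) ≤ q' * ‖x‖ :=
      (mul_le_of_le_one_right (norm_nonneg _)
        (Real.rpow_le_one hl.le (by linarith) hθ)).trans (Q'.le_of_opNorm_le hQ' x)
    calc ‖(B ^ n) (R lam x)‖ * a ^ (1 - 1 / p)
        ≤ (‖μ‖ ^ n * ‖R lam x‖ + ‖Q' x‖) * a ^ (1 - 1 / p) := by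
          rw [h3]
          gcongr
          refine (norm_add_le _ _).trans_eq ?_
          rw [norm_smul, norm_pow]
      _ ≤ L ^ (1 / p) * c ^ (1 - 1 / p) * ‖x‖ + q' * ‖x‖ := by
          rw [add_mul]
          exact add_le_add h2 h4
      _ ≤ _ := by
          rw [add_mul, add_mul]
          have : 0 ≤ ‖B ^ n‖ * c * 2 * ‖x‖ := by positivity
          linarith
  · have h1 : a ^ (1 - 1 / p) ≤ 2 * a := by
      rw [Real.rpow_sub hl, Real.rpow_one, div_le_iff₀ (by positivity), mul_comm 2 a, mul_assoc]
      refine le_mul_of_one_le_right hl.le ?_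
      have h2 : (1 / 2 : ℝ) ≤ (1 / 2 : ℝ) ^ (1 / p) := by
        simpa using Real.rpow_le_rpow_of_exponent_ge (x := 1 / 2) (by norm_num) (by norm_num) hp1
      have h3 : (1 / 2 : ℝ) ^ (1 / p) ≤ a ^ (1 / p) := by gcongr
      linarith
    calc ‖(B ^ n) (R lam x)‖ * a ^ (1 - 1 / p) ≤ ‖B ^ n‖ * (c * ‖x‖ / a) * (2 * a) := by
          gcongr
          exact (B ^ n).le_opNorm_of_le hRx
      _ = ‖B ^ n‖ * c * 2 * ‖x‖ := by field_simp
      _ ≤ _ := by gcongr; linarith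

end IsBoundedSemigroup

theorem IsBoundedSemigroup.exists_norm_comp_le {X : Type*} [NormedAddCommGroup X]
    [InnerProductSpace ℂ X] [CompleteSpace X] {T : ℝ → X →L[ℂ] X} {c : ℝ} {Dom : Set X}
    {A : X → X} {R : ℂ → X →L[ℂ] X} (H : IsBoundedSemigroup T c Dom A R)
    {k : ℕ} (hk : k = 1 ∨ k = 2) {n : ℕ} (hn : 1 ≤ n) {p K : ℝ} (hp : 1 ≤ p) (hK : 0 < K)
    (hBR : ∀ lam : ℂ, 0 < lam.re → ∀ x : X,
      ‖(((R 1 - 1) * (R 1) ^ (k - 1)) ^ n) (R lam x)‖ ≤ K * ‖x‖ / lam.re ^ (1 - 1 / p)) :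
    ∃ M > 0, ∀ t : ℝ, 0 < t →
      ‖(T t) ∘L ((R 1 - 1) * (R 1) ^ (k - 1))‖ ≤ M * t ^ (-(1 / ((n : ℝ) * p))) := by
  have hc := H.one_le
  have hc0 := H.pos
  obtain ⟨m, rfl⟩ : ∃ m, n = m + 1 := ⟨n - 1, by omega⟩
  set B := (R 1 - 1) * (R 1) ^ (k - 1) with hB
  have hcomm (t : ℝ) (ht : 0 ≤ t) : Commute (T t) B := by
    have h := H.commute_resolvent ht (lam := 1) (by simp)
    exact (h.sub_right (Commute.one_right _)).mul_right (h.pow_right _)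
  obtain ⟨C, hC, hmom⟩ := exists_norm_apply_pow_le (B := B) (C := 1 + c * (1 + c)) (by positivity)
    (fun s hs ↦ by
      rcases hk with rfl | rfl
      · simpa [hB] using H.exists_left_inverse_one hs
      · simpa [hB] using H.exists_left_inverse_two hs) m
  set C₁ := 2 * Real.exp 1 * c ^ 2 * K with hC₁
  have hC₁0 : 0 < C₁ := by positivity
  have hm : ((m + 1 : ℕ) : ℝ) ≠ 0 := by positivity
  set C₂ := C * c ^ m * C₁ with hC₂
  have hC₂0 : 0 < C₂ := by positivity
  refine ⟨C₂ ^ (1 / ((m + 1 : ℕ) : ℝ)), by positivity, fun t ht ↦ ?_⟩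
  refine ContinuousLinearMap.opNorm_le_bound _ (by positivity) fun x ↦ ?_
  have h1 : (T t ∘L B) x = B (T t x) := DFunLike.congr_fun (hcomm t ht.le).eq x
  have h2 : ‖(B ^ (m + 1)) (T t x)‖ ≤ C₁ * t ^ (-(1 / p)) * ‖x‖ := by
    have := H.norm_apply_orbit_le_rpow (fun t ht ↦ (hcomm t ht).pow_right (m + 1)) hK hBR ht x
    rwa [show 1 - 1 / p - 1 = -(1 / p) by ring] at this
  rw [h1]
  refine le_of_pow_le_pow_left₀ (n := m + 1) (by simp) (by positivity) ?_
  have h3 : (C₂ ^ (1 / ((m + 1 : ℕ) : ℝ))) ^ (m + 1) = C₂ := by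
    rw [← Real.rpow_natCast, ← Real.rpow_mul hC₂0.le, one_div_mul_cancel hm, Real.rpow_one]
  have h4 : (t ^ (-(1 / (((m + 1 : ℕ) : ℝ) * p)))) ^ (m + 1) = t ^ (-(1 / p)) := by
    rw [← Real.rpow_natCast, ← Real.rpow_mul ht.le]
    congr 1
    field_simp
  calc ‖B (T t x)‖ ^ (m + 1) ≤ C * ‖T t x‖ ^ m * ‖(B ^ (m + 1)) (T t x)‖ := hmom _
    _ ≤ C * (c * ‖x‖) ^ m * (C₁ * t ^ (-(1 / p)) * ‖x‖) := by
      gcongr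
      exact H.norm_apply_le ht.le x
    _ = _ := by
      rw [mul_pow, mul_pow, mul_pow, h3, h4, hC₂]
      ring

/-- For a bounded C₀-semigroup on a Hilbert space with generator `A` such
that `0 ∈ σ(A)` (i.e. `A` has no bounded inverse), and `k ∈ {1,2}`, polynomial decay
`‖T(t)A(I-A)^{-k}‖ = O(t^(-1/(np)))` is equivalent to the `p`-Weiss condition for
`(A(I-A)^{-k})ⁿ`.  Here `(I-A)^{-1} = R(1,A)` and `A(I-A)^{-k} = (R(1,A) - 1) * R(1,A)^(k-1)`
as bounded operators. -/
theorem stmt_3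
    {X : Type*} [NormedAddCommGroup X] [InnerProductSpace ℂ X] [CompleteSpace X]
    (T : ℝ → X →L[ℂ] X)
    (hT0 : T 0 = 1)
    (hTsemi : ∀ s t : ℝ, 0 ≤ s → 0 ≤ t → T (s + t) = T s ∘L T t)
    (hTcont : ∀ x : X, ContinuousOn (fun t : ℝ => T t x) (Set.Ici 0))
    (hTbdd : ∃ c : ℝ, ∀ t : ℝ, 0 ≤ t → ‖T t‖ ≤ c)
    (Dom : Set X) (A : X → X)
    (hgen : ∀ x y, (x ∈ Dom ∧ A x = y) ↔
      Filter.Tendsto (fun t : ℝ => (t : ℂ)⁻¹ • (T t x - x))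
        (nhdsWithin 0 (Set.Ioi 0)) (nhds y))
    (R : ℂ → X →L[ℂ] X)
    (hR₁ : ∀ lam : ℂ, 0 < lam.re → ∀ x, R lam x ∈ Dom ∧ lam • R lam x - A (R lam x) = x)
    (hR₂ : ∀ lam : ℂ, 0 < lam.re → ∀ x ∈ Dom, R lam (lam • x - A x) = x)
    (hspec : ¬ ∃ S : X →L[ℂ] X, (∀ x, S x ∈ Dom ∧ A (S x) = x) ∧ (∀ x ∈ Dom, S (A x) = x))
    (n : ℕ) (hn : 1 ≤ n) (p : ℝ) (hp : 1 ≤ p) (k : ℕ) (hk : k = 1 ∨ k = 2) :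
    (∃ M > 0, ∃ t₁ > 0, ∀ t : ℝ, t₁ ≤ t →
        ‖(T t) ∘L ((R 1 - 1) * (R 1) ^ (k - 1))‖ ≤ M * t ^ (-(1 / ((n : ℝ) * p))))
      ↔ (∃ K > 0, ∀ lam : ℂ, 0 < lam.re → ∀ x : X,
          ‖(((R 1 - 1) * (R 1) ^ (k - 1)) ^ n) (R lam x)‖ ≤ K * ‖x‖ / lam.re ^ (1 - 1 / p)) := by
  obtain ⟨c₀, hc₀⟩ := hTbdd
  have H : IsBoundedSemigroup T (max c₀ 1) Dom A R :=
    ⟨hT0, hTsemi, hTcont, le_max_right _ _, fun t ht ↦ (hc₀ t ht).trans (le_max_left _ _), hgen,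
      hR₁, hR₂⟩
  constructor
  · rintro ⟨M, hM, t₁, ht₁, hB⟩
    exact H.exists_norm_pow_apply_resolvent_le hk hn hp hM ht₁ hB
  · rintro ⟨K, hK, hBR⟩
    obtain ⟨M, hM, h⟩ := H.exists_norm_comp_le hk hn hp hK hBR
    exact ⟨M, hM, 1, one_pos, fun t ht ↦ h t (one_pos.trans_le ht)⟩
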